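/- arXiv:2406.12659 — 6 statements merged into one kernel-verified Lean document; each statement's English description precedes it below -/
import Mathlib

section
/- Under the posterior distribution Π(·|Y), the transformed coordinates β₁* and β₋₁ are independent; more precisely, the pushforward of Π(·|Y) under the bijection β ↦ (β₁*, β₋₁) equals the product measure ν₁ ⊗ ν₂, where ν₁ is the probability measure on ℝ with density proportional to u ↦ exp(−(‖X₁‖₂²/2)(u − X₁ᵀY/‖X₁‖₂²)²) g(u) with respect to Lebesgue measure, and ν₂ is the probability measure on ℝ^{p−1} with dν₂(β₋₁) proportional to exp(−‖Y̌ − W̌β₋₁‖₂²/2) dμ(β₋₁). -/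
open Matrix Finset MeasureTheory

/-- Normalization of a (finite, nonzero) measure into a probability measure:
the probability measure proportional to `ρ`. -/
noncomputable def probNormalize {α : Type*} [MeasurableSpace α]
    (ρ : MeasureTheory.Measure α) : MeasureTheory.Measure α :=
  (ρ Set.univ)⁻¹ • ρ

/-- Pythagorean decomposition of the residual sum of squares along a nonzero vector `x`. -/
theorem sum_sq_sub_smul_eq {k l : ℕ} (x q : Fin k → ℝ) (hx : (∑ i, x i ^ 2) ≠ 0)
    (P : Matrix (Fin k) (Fin l) ℝ)
    (hP : P * P.transpose = 1 - Matrix.of fun i j => x i * x j / (∑ l, x l ^ 2)) (t : ℝ) :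
    ∑ i, (q i - t * x i) ^ 2
      = (∑ i, x i ^ 2) * (t - (∑ i, x i * q i) / (∑ i, x i ^ 2)) ^ 2
        + ∑ j, (P.transpose.mulVec q j) ^ 2 := by
  have h1 : ∑ j, (P.transpose.mulVec q j) ^ 2 = q ⬝ᵥ ((P * P.transpose).mulVec q) := by
    rw [← Matrix.mulVec_mulVec, Matrix.dotProduct_mulVec, ← Matrix.mulVec_transpose]
    simp [dotProduct, sq]
  have h2 : (Matrix.of fun i j => x i * x j / (∑ l, x l ^ 2)).mulVec q
      = fun i => x i * ((∑ j, x j * q j) / (∑ l, x l ^ 2)) := by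
    ext i
    simp only [Matrix.mulVec, dotProduct, Matrix.of_apply, Finset.sum_div, Finset.mul_sum]
    exact Finset.sum_congr rfl fun j _ => by ring
  have h3 : q ⬝ᵥ ((P * P.transpose).mulVec q)
      = ∑ i, q i ^ 2 - (∑ i, x i * q i) ^ 2 / (∑ i, x i ^ 2) := by
    rw [hP, Matrix.sub_mulVec, Matrix.one_mulVec, h2, dotProduct_sub]
    congr 1
    · simp [dotProduct, sq]
    · simp only [dotProduct]
      rw [sq, mul_div_assoc, Finset.sum_mul]
      exact Finset.sum_congr rfl fun j _ => by ring
  have h4 : ∑ i, (q i - t * x i) ^ 2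
      = ∑ i, q i ^ 2 - 2 * t * (∑ i, x i * q i) + t ^ 2 * ∑ i, x i ^ 2 := by
    rw [Finset.mul_sum, Finset.mul_sum, ← Finset.sum_sub_distrib, ← Finset.sum_add_distrib]
    exact Finset.sum_congr rfl fun j _ => by ring
  rw [h1, h3, h4]
  field_simp
  ring

/-- Shearing the first coordinate by a measurable function of the second one preserves the
product of Lebesgue measure with any s-finite measure. -/
theorem measurePreserving_shear {α : Type*} [MeasurableSpace α] (μ : Measure α) [SFinite μ]
    (c : α → ℝ) (hc : Measurable c) :
    MeasurePreserving (fun z : ℝ × α => (z.1 + c z.2, z.2))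
      ((volume : Measure ℝ).prod μ) ((volume : Measure ℝ).prod μ) := by
  have h : MeasurePreserving (fun z : α × ℝ => (z.1, z.2 + c z.1))
      (μ.prod volume) (μ.prod volume) :=
    (MeasurePreserving.id μ).skew_product (g := fun a u => u + c a)
      (measurable_snd.add (hc.comp measurable_fst))
      (Filter.Eventually.of_forall fun a => map_add_right_eq_self volume (c a))
  exact Measure.measurePreserving_swap.comp (h.comp Measure.measurePreserving_swap)

/-- Pushing forward a measure whose density factors through a measure-preserving map. -/
theorem MeasureTheory.MeasurePreserving.map_withDensity_comp {α β : Type*} [MeasurableSpace α]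
    [MeasurableSpace β] {ρ : Measure α} {κ : Measure β} {T : α → β}
    (hT : MeasurePreserving T ρ κ) {F : β → ENNReal} (hF : Measurable F) :
    (ρ.withDensity fun z => F (T z)).map T = κ.withDensity F := by
  ext s hs
  rw [Measure.map_apply hT.measurable hs, withDensity_apply _ (hT.measurable hs),
    withDensity_apply _ hs, ← hT.setLIntegral_comp_preimage hs hF]

/-- Normalization commutes with products of nonzero measures. -/
theorem probNormalize_prod {α β : Type*} [MeasurableSpace α] [MeasurableSpace β]
    (ρ : Measure α) (κ : Measure β) [SFinite ρ] [SFinite κ]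
    (h : ρ.prod κ Set.univ ≠ 0) :
    probNormalize (ρ.prod κ) = (probNormalize ρ).prod (probNormalize κ) := by
  have hZ : ρ.prod κ Set.univ = ρ Set.univ * κ Set.univ := by
    rw [← Set.univ_prod_univ, Measure.prod_prod]
  have h0 := mul_ne_zero_iff.1 (hZ ▸ h)
  unfold probNormalize
  rw [Measure.prod_smul_left, Measure.prod_smul_right, smul_smul, hZ,
    ENNReal.mul_inv (Or.inl h0.1) (Or.inr h0.2)]

/-- Normalization commutes with pushforward. -/
theorem map_probNormalize {α β : Type*} [MeasurableSpace α] [MeasurableSpace β]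
    (ρ : Measure α) {T : α → β} (hT : Measurable T) :
    (probNormalize ρ).map T = probNormalize (ρ.map T) := by
  unfold probNormalize
  rw [Measure.map_smul, Measure.map_apply hT MeasurableSet.univ, Set.preimage_univ]

/-- Under the posterior `Π(·|Y)` the transformed coordinates `β₁*` and `β₋₁`
are independent: the pushforward of the posterior under `β ↦ (β₁*, β₋₁)` equals `ν₁ ⊗ ν₂`,
where `ν₁ ∝ exp(−(‖X₁‖₂²/2)(u − X₁ᵀY/‖X₁‖₂²)²) g(u) du` and
`ν₂ ∝ exp(−‖Y̌ − W̌β₋₁‖₂²/2) dμ(β₋₁)`.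
Here `ℝᵖ` is identified with `ℝ × ℝ^{p−1}` via `β = (β₁, β₋₁)`, `n = ν + 1`, `p = m + 1`,
the prior is `(Leb ⊗ μ).withDensity (g(β₁ + ∑ γᵢ βᵢ))`, and the posterior is the normalized
likelihood-weighted prior (normalizing constant assumed finite and positive). -/
theorem stmt2 (ν m : ℕ) (hν : 1 ≤ ν) (hm : 1 ≤ m)
    (X : Matrix (Fin (ν + 1)) (Fin (m + 1)) ℝ)
    (hX1 : (fun i => X i 0) ≠ 0)
    (P : Matrix (Fin (ν + 1)) (Fin ν) ℝ)
    (hPtP : P.transpose * P = 1)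
    (hPPt : P * P.transpose
      = 1 - Matrix.of fun i j => X i 0 * X j 0 / (∑ l, X l 0 ^ 2))
    (g : ℝ → ℝ) (hg_meas : Measurable g) (hg_pos : ∀ x, 0 < g x)
    (hg_int : ∫ x, g x = 1)
    (μ : Measure (Fin m → ℝ)) [IsProbabilityMeasure μ]
    (Y : Fin (ν + 1) → ℝ)
    (γ : Fin (m + 1) → ℝ)
    (hγ : γ = fun j => (∑ i, X i 0 * X i j) / (∑ l, X l 0 ^ 2))
    (priorM : Measure (ℝ × (Fin m → ℝ)))
    (hpriorM : priorM = ((volume : Measure ℝ).prod μ).withDensity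
        (fun z => ENNReal.ofReal (g (z.1 + ∑ j : Fin m, γ j.succ * z.2 j))))
    (ρpost : Measure (ℝ × (Fin m → ℝ)))
    (hρpost : ρpost = priorM.withDensity
        (fun z => ENNReal.ofReal
          (Real.exp (-(∑ i, (Y i - X.mulVec (Fin.cons z.1 z.2) i) ^ 2) / 2))))
    (hZpos : 0 < ρpost Set.univ) (hZfin : ρpost Set.univ < ⊤) :
    (probNormalize ρpost).map
        (fun z : ℝ × (Fin m → ℝ) => (z.1 + ∑ j : Fin m, γ j.succ * z.2 j, z.2))
      = (probNormalize ((volume : Measure ℝ).withDensity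
            (fun u => ENNReal.ofReal
              (Real.exp (-(∑ l, X l 0 ^ 2) / 2
                  * (u - (∑ i, X i 0 * Y i) / (∑ l, X l 0 ^ 2)) ^ 2) * g u)))).prod
        (probNormalize (μ.withDensity
            (fun b => ENNReal.ofReal
              (Real.exp (-(∑ j, (P.transpose.mulVec Y j
                  - (P.transpose * Matrix.of fun i j' => X i j'.succ).mulVec b j) ^ 2) / 2))))) := by
  have hS : (∑ l, X l 0 ^ 2) ≠ 0 := fun h => hX1 <| funext fun i => by
    simpa using (Finset.sum_eq_zero_iff_of_nonneg fun l _ => sq_nonneg (X l 0)).1 h i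
      (Finset.mem_univ i)
  set c : (Fin m → ℝ) → ℝ := fun b => ∑ j : Fin m, γ j.succ * b j with hc
  have hc_meas : Measurable c := by fun_prop
  set f₁ : ℝ → ENNReal := fun u => ENNReal.ofReal
    (Real.exp (-(∑ l, X l 0 ^ 2) / 2
      * (u - (∑ i, X i 0 * Y i) / (∑ l, X l 0 ^ 2)) ^ 2) * g u) with hf₁
  set f₂ : (Fin m → ℝ) → ENNReal := fun b => ENNReal.ofReal
    (Real.exp (-(∑ j, (P.transpose.mulVec Y j
      - (P.transpose * Matrix.of fun i j' => X i j'.succ).mulVec b j) ^ 2) / 2)) with hf₂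
  have hf₁_meas : Measurable f₁ := by fun_prop
  have hf₂_meas : Measurable f₂ := by
    simp only [hf₂, Matrix.mulVec, dotProduct]
    fun_prop
  have hlik_meas : Measurable fun z : ℝ × (Fin m → ℝ) => ENNReal.ofReal
      (Real.exp (-(∑ i, (Y i - X.mulVec (Fin.cons z.1 z.2) i) ^ 2) / 2)) := by
    simp only [Matrix.mulVec, dotProduct, Fin.sum_univ_succ, Fin.cons_zero, Fin.cons_succ]
    fun_prop
  have hT := measurePreserving_shear μ c hc_meas
  have hrss : ∀ (t : ℝ) (b : Fin m → ℝ),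
      ∑ i, (Y i - X.mulVec (Fin.cons t b) i) ^ 2
        = (∑ l, X l 0 ^ 2) * (t + c b - (∑ i, X i 0 * Y i) / (∑ l, X l 0 ^ 2)) ^ 2
          + ∑ j, (P.transpose.mulVec Y j
            - (P.transpose * Matrix.of fun i j' => X i j'.succ).mulVec b j) ^ 2 := by
    intro t b
    set W : Matrix (Fin (ν + 1)) (Fin m) ℝ := Matrix.of fun i j' => X i j'.succ with hW
    have hcb : c b = (∑ i, X i 0 * W.mulVec b i) / (∑ l, X l 0 ^ 2) := by
      simp only [hc, hγ, hW, Matrix.mulVec, dotProduct, Matrix.of_apply, Finset.mul_sum,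
        Finset.sum_div, Finset.sum_mul]
      rw [Finset.sum_comm]
      exact Finset.sum_congr rfl fun i _ => Finset.sum_congr rfl fun j _ => by ring
    have hq : t + c b - (∑ i, X i 0 * Y i) / (∑ l, X l 0 ^ 2)
        = t - (∑ i, X i 0 * (Y - W.mulVec b) i) / (∑ l, X l 0 ^ 2) := by
      simp only [hcb, Pi.sub_apply, mul_sub, Finset.sum_sub_distrib]
      ring
    have hres : ∀ i, Y i - X.mulVec (Fin.cons t b) i = (Y - W.mulVec b) i - t * X i 0 := by
      intro i
      simp only [Matrix.mulVec, dotProduct, Fin.sum_univ_succ, Fin.cons_zero, Fin.cons_succ,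
        Pi.sub_apply, hW, Matrix.of_apply]
      ring
    have hproj : ∀ j, P.transpose.mulVec Y j - (P.transpose * W).mulVec b j
        = P.transpose.mulVec (Y - W.mulVec b) j := by
      intro j
      rw [Matrix.mulVec_sub, Matrix.mulVec_mulVec, Pi.sub_apply]
    simp only [hq, hres, hproj]
    exact sum_sq_sub_smul_eq (fun i => X i 0) _ hS P hPPt t
  have hprior_meas : Measurable fun z : ℝ × (Fin m → ℝ) => ENNReal.ofReal (g (z.1 + c z.2)) := by
    fun_prop
  have hpost : ρpost = ((volume : Measure ℝ).prod μ).withDensity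
      fun z => (fun w : ℝ × (Fin m → ℝ) => f₁ w.1 * f₂ w.2) (z.1 + c z.2, z.2) := by
    rw [hρpost, hpriorM, ← withDensity_mul _ hprior_meas hlik_meas]
    congr 1
    funext z
    simp only [Pi.mul_apply, hf₁, hf₂, hrss]
    rw [← ENNReal.ofReal_mul (hg_pos _).le,
      ← ENNReal.ofReal_mul (mul_nonneg (Real.exp_pos _).le (hg_pos _).le),
      mul_right_comm, ← Real.exp_add, mul_comm]
    congr 3
    ring
  have hmap : ρpost.map (fun z : ℝ × (Fin m → ℝ) => (z.1 + c z.2, z.2))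
      = ((volume : Measure ℝ).withDensity f₁).prod (μ.withDensity f₂) := by
    rw [hpost, prod_withDensity hf₁_meas hf₂_meas]
    exact hT.map_withDensity_comp (F := fun w => f₁ w.1 * f₂ w.2) (by fun_prop)
  have hmass : ((volume : Measure ℝ).withDensity f₁).prod (μ.withDensity f₂) Set.univ ≠ 0 := by
    rw [← hmap, Measure.map_apply hT.measurable MeasurableSet.univ, Set.preimage_univ]
    exact hZpos.ne'
  rw [← probNormalize_prod _ _ hmass, ← hmap]
  exact map_probNormalize ρpost hT.measurable
end

section
/- Let g be an everywhere-positive probability density on ℝ such that log g is c-Lipschitz for some c ≥ 0. Then for every a > 0, m ∈ ℝ and t ∈ ℝ, the ratio (∫ℝ e^{ta(u−m)} e^{−a²(u−m)²/2} g(u) du) / (∫ℝ e^{−a²(u−m)²/2} g(u) du) is at most (∫ℝ e^{tu − u²/2 + (c/a)|u|} du) / (∫ℝ e^{−u²/2 − (c/a)|u|} du), and at least (∫ℝ e^{tu − u²/2 − (c/a)|u|} du) / (∫ℝ e^{−u²/2 + (c/a)|u|} du). -/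
open MeasureTheory Real

lemma integrable_exp_mul_sub_sq_add_mul_abs (t k : ℝ) :
    Integrable (fun u : ℝ ↦ Real.exp (t * u - u ^ 2 / 2 + k * |u|)) := by
  have hdom : Integrable (fun u : ℝ ↦
      Real.exp ((|t| + |k|) ^ 2) * Real.exp (-(1 / 4) * u ^ 2)) :=
    (integrable_exp_neg_mul_sq (by norm_num)).const_mul _
  refine hdom.mono' (by fun_prop) (.of_forall fun u ↦ ?_)
  rw [Real.norm_of_nonneg (Real.exp_pos _).le, ← Real.exp_add, Real.exp_le_exp]
  have htu : t * u ≤ |t| * |u| := (le_abs_self _).trans (abs_mul t u).le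
  have hku : k * |u| ≤ |k| * |u| := mul_le_mul_of_nonneg_right (le_abs_self k) (abs_nonneg u)
  nlinarith [sq_nonneg (|t| + |k| - |u| / 2), sq_abs u]

lemma integral_exp_mul_sub_sq_add_mul_abs_pos (t k : ℝ) :
    0 < ∫ u : ℝ, Real.exp (t * u - u ^ 2 / 2 + k * |u|) :=
  integral_exp_pos (integrable_exp_mul_sub_sq_add_mul_abs t k)

/-- A function squeezed between `C e^{-k|u|}` and `C e^{k|u|}` has its tilted Gaussian integral
squeezed between the corresponding tilted Gaussian integrals. -/
lemma integral_exp_mul_sub_sq_mul_bounds {h : ℝ → ℝ} (hh : Measurable h) {C k : ℝ} (hC : 0 ≤ C)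
    (hlow : ∀ u, C * Real.exp (-k * |u|) ≤ h u) (hupp : ∀ u, h u ≤ C * Real.exp (k * |u|))
    (t : ℝ) :
    C * (∫ u : ℝ, Real.exp (t * u - u ^ 2 / 2 + -k * |u|))
        ≤ ∫ u : ℝ, Real.exp (t * u - u ^ 2 / 2) * h u ∧
      ∫ u : ℝ, Real.exp (t * u - u ^ 2 / 2) * h u
        ≤ C * ∫ u : ℝ, Real.exp (t * u - u ^ 2 / 2 + k * |u|) := by
  have hilow := (integrable_exp_mul_sub_sq_add_mul_abs t (-k)).const_mul C
  have hiupp := (integrable_exp_mul_sub_sq_add_mul_abs t k).const_mul C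
  have hl (u : ℝ) : C * Real.exp (t * u - u ^ 2 / 2 + -k * |u|)
      ≤ Real.exp (t * u - u ^ 2 / 2) * h u := by
    rw [Real.exp_add, mul_left_comm]
    exact mul_le_mul_of_nonneg_left (hlow u) (Real.exp_pos _).le
  have hu (u : ℝ) : Real.exp (t * u - u ^ 2 / 2) * h u
      ≤ C * Real.exp (t * u - u ^ 2 / 2 + k * |u|) := by
    rw [Real.exp_add, mul_left_comm]
    exact mul_le_mul_of_nonneg_left (hupp u) (Real.exp_pos _).le
  have hi : Integrable (fun u : ℝ ↦ Real.exp (t * u - u ^ 2 / 2) * h u) := by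
    refine hiupp.mono' (by fun_prop) (.of_forall fun u ↦ ?_)
    rw [Real.norm_of_nonneg ((mul_nonneg hC (Real.exp_pos _).le).trans (hl u))]
    exact hu u
  rw [← integral_const_mul, ← integral_const_mul]
  exact ⟨integral_mono hilow hi hl, integral_mono hi hiupp hu⟩

lemma integral_comp_mul_sub (F : ℝ → ℝ) {a : ℝ} (ha : 0 < a) (m : ℝ) :
    ∫ u, F (a * (u - m)) = a⁻¹ * ∫ v, F v := by
  rw [integral_sub_right_eq_self (fun x ↦ F (a * x)) m, Measure.integral_comp_mul_left F a,
    abs_of_pos (inv_pos.2 ha), smul_eq_mul]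

lemma exp_bounds_of_log_lipschitz {g : ℝ → ℝ} (hg_pos : ∀ x, 0 < g x) {c : ℝ}
    (hlip : ∀ x y : ℝ, |Real.log (g x) - Real.log (g y)| ≤ c * |x - y|) (x y : ℝ) :
    g y * Real.exp (-(c * |x - y|)) ≤ g x ∧ g x ≤ g y * Real.exp (c * |x - y|) := by
  have h := abs_le.1 (hlip x y)
  rw [← Real.exp_log (hg_pos x), ← Real.exp_log (hg_pos y), ← Real.exp_add, ← Real.exp_add,
    Real.exp_le_exp, Real.exp_le_exp]
  constructor <;> linarith

/-- If `g` is an everywhere-positive probability density on `ℝ` with `log g`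
`c`-Lipschitz, then for every `a > 0`, `m ∈ ℝ` and `t ∈ ℝ`,
`(∫ e^{ta(u−m)} e^{−a²(u−m)²/2} g(u) du)/(∫ e^{−a²(u−m)²/2} g(u) du)` is bounded above by
`(∫ e^{tu − u²/2 + (c/a)|u|} du)/(∫ e^{−u²/2 − (c/a)|u|} du)` and below by
`(∫ e^{tu − u²/2 − (c/a)|u|} du)/(∫ e^{−u²/2 + (c/a)|u|} du)`. -/
theorem stmt5 (g : ℝ → ℝ) (hg_meas : Measurable g) (hg_pos : ∀ x, 0 < g x)
    (hg_int : ∫ x, g x = 1)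
    (c : ℝ) (hc : 0 ≤ c)
    (hlip : ∀ x y : ℝ, |Real.log (g x) - Real.log (g y)| ≤ c * |x - y|)
    (a : ℝ) (ha : 0 < a) (m t : ℝ) :
    (∫ u, Real.exp (t * a * (u - m)) * Real.exp (-(a ^ 2 * (u - m) ^ 2) / 2) * g u)
        / (∫ u, Real.exp (-(a ^ 2 * (u - m) ^ 2) / 2) * g u)
      ≤ (∫ u, Real.exp (t * u - u ^ 2 / 2 + (c / a) * |u|))
          / (∫ u, Real.exp (-(u ^ 2) / 2 - (c / a) * |u|))
    ∧
    (∫ u, Real.exp (t * u - u ^ 2 / 2 - (c / a) * |u|))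
        / (∫ u, Real.exp (-(u ^ 2) / 2 + (c / a) * |u|))
      ≤ (∫ u, Real.exp (t * a * (u - m)) * Real.exp (-(a ^ 2 * (u - m) ^ 2) / 2) * g u)
          / (∫ u, Real.exp (-(a ^ 2 * (u - m) ^ 2) / 2) * g u) := by
  set h : ℝ → ℝ := fun v ↦ g (m + v / a) with hdef
  have hh : Measurable h := hg_meas.comp (by fun_prop)
  have hdist (v : ℝ) : c * |m + v / a - m| = c / a * |v| := by
    rw [add_sub_cancel_left, abs_div, abs_of_pos ha]
    ring
  have hlow (v : ℝ) : g m * Real.exp (-(c / a) * |v|) ≤ h v := by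
    have := (exp_bounds_of_log_lipschitz hg_pos hlip (m + v / a) m).1
    rwa [hdist, ← neg_mul] at this
  have hupp (v : ℝ) : h v ≤ g m * Real.exp (c / a * |v|) := by
    have := (exp_bounds_of_log_lipschitz hg_pos hlip (m + v / a) m).2
    rwa [hdist] at this
  have hcomp (u : ℝ) : h (a * (u - m)) = g u := by
    simp only [hdef]
    congr 1
    field_simp
    ring
  have hN : ∫ u, Real.exp (t * a * (u - m)) * Real.exp (-(a ^ 2 * (u - m) ^ 2) / 2) * g u
      = a⁻¹ * ∫ v, Real.exp (t * v - v ^ 2 / 2) * h v := by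
    rw [← integral_comp_mul_sub (fun v ↦ Real.exp (t * v - v ^ 2 / 2) * h v) ha m]
    refine integral_congr_ae (.of_forall fun u ↦ ?_)
    simp only [hcomp, ← Real.exp_add]
    ring_nf
  have hD : ∫ u, Real.exp (-(a ^ 2 * (u - m) ^ 2) / 2) * g u
      = a⁻¹ * ∫ v, Real.exp (0 * v - v ^ 2 / 2) * h v := by
    rw [← integral_comp_mul_sub (fun v ↦ Real.exp (0 * v - v ^ 2 / 2) * h v) ha m]
    refine integral_congr_ae (.of_forall fun u ↦ ?_)
    simp only [hcomp]
    ring_nf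
  have hE (k : ℝ) : ∫ u : ℝ, Real.exp (-(u ^ 2) / 2 + k * |u|)
      = ∫ u : ℝ, Real.exp (0 * u - u ^ 2 / 2 + k * |u|) := by
    simp only [zero_mul, zero_sub, neg_div]
  have ha' : a⁻¹ ≠ 0 := inv_ne_zero ha.ne'
  have hgm := hg_pos m
  obtain ⟨hN₁, hN₂⟩ := integral_exp_mul_sub_sq_mul_bounds hh hgm.le hlow hupp t
  obtain ⟨hD₁, hD₂⟩ := integral_exp_mul_sub_sq_mul_bounds hh hgm.le hlow hupp 0
  have hpos := integral_exp_mul_sub_sq_add_mul_abs_pos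
  have hDpos := (mul_pos hgm (hpos 0 (-(c / a)))).trans_le hD₁
  rw [hN, hD, mul_div_mul_left _ _ ha']
  simp only [sub_eq_add_neg _ (c / a * |_|), ← neg_mul (c / a), hE]
  constructor
  · rw [← mul_div_mul_left _ (∫ u : ℝ, Real.exp (0 * u - u ^ 2 / 2 + -(c / a) * |u|)) hgm.ne']
    exact div_le_div₀ (mul_pos hgm (hpos t (c / a))).le hN₂
      (mul_pos hgm (hpos 0 (-(c / a)))) hD₁
  · rw [← mul_div_mul_left _ (∫ u : ℝ, Real.exp (0 * u - u ^ 2 / 2 + c / a * |u|)) hgm.ne']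
    exact div_le_div₀ ((mul_pos hgm (hpos t (-(c / a)))).le.trans hN₁) hN₁ hDpos hD₂
end

section
/- For any integer s with 2 ≤ s ≤ p, the smallest sparse scaled singular value of the transformed design satisfies φ̃^{W̌}(s−1) ≥ φ̃^X(s) − (‖X₁‖₂/‖W̌‖) · √s · max_{2 ≤ i ≤ p} |γᵢ|. -/
open Matrix Finset

/-- `‖A‖ = max_i ‖A_i‖₂`: the maximal Euclidean column norm of a matrix. -/
noncomputable def colMaxNorm {n d : ℕ} [NeZero d] (A : Matrix (Fin n) (Fin d) ℝ) : ℝ :=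
  Finset.univ.sup' Finset.univ_nonempty fun j => Real.sqrt (∑ i, A i j ^ 2)

/-- The smallest sparse scaled singular value of dimension `s`:
`φ̃^A(s) = inf { ‖Aβ‖₂/(‖A‖‖β‖₂) : β ≠ 0, |S_β| ≤ s }`, `S_β` the support of `β`. -/
noncomputable def sparseSingVal {n d : ℕ} [NeZero d] (A : Matrix (Fin n) (Fin d) ℝ)
    (s : ℕ) : ℝ :=
  sInf { r : ℝ | ∃ β : Fin d → ℝ, β ≠ 0 ∧
    (Finset.univ.filter fun i => β i ≠ 0).card ≤ s ∧
    r = Real.sqrt (∑ j, A.mulVec β j ^ 2)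
          / (colMaxNorm A * Real.sqrt (∑ i, β i ^ 2)) }

theorem sum_sq_transpose_mulVec {k l : ℕ} (x : Fin k → ℝ) (P : Matrix (Fin k) (Fin l) ℝ)
    (hP : P * P.transpose = 1 - Matrix.of fun i j => x i * x j / (∑ a, x a ^ 2))
    (v : Fin k → ℝ) :
    ∑ j, (P.transpose *ᵥ v) j ^ 2 = ∑ i, v i ^ 2 - (x ⬝ᵥ v) ^ 2 / (∑ a, x a ^ 2) := by
  have h1 : ∑ j, (P.transpose *ᵥ v) j ^ 2 = v ⬝ᵥ ((P * P.transpose) *ᵥ v) := by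
    rw [← mulVec_mulVec, dotProduct_mulVec, ← mulVec_transpose]
    simp only [dotProduct, sq]
  have h2 : (Matrix.of fun i j => x i * x j / (∑ a, x a ^ 2)) *ᵥ v
      = ((x ⬝ᵥ v) / (∑ a, x a ^ 2)) • x := by
    ext i
    simp only [mulVec, dotProduct, of_apply, Pi.smul_apply, smul_eq_mul, sum_div, sum_mul]
    exact sum_congr rfl fun j _ => by ring
  rw [h1, hP, sub_mulVec, one_mulVec, h2, dotProduct_sub, dotProduct_smul, smul_eq_mul,
    dotProduct_comm v x]
  congr 1
  · simp only [dotProduct, sq]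
  · ring

theorem colMaxNorm_nonneg {n d : ℕ} [NeZero d] (A : Matrix (Fin n) (Fin d) ℝ) :
    0 ≤ colMaxNorm A :=
  (Real.sqrt_nonneg _).trans
    (le_sup' (fun j => Real.sqrt (∑ i, A i j ^ 2)) (mem_univ (0 : Fin d)))

theorem colMaxNorm_pos {n d : ℕ} [NeZero d] {A : Matrix (Fin n) (Fin d) ℝ} (hA : A ≠ 0) :
    0 < colMaxNorm A := by
  obtain ⟨i, j, hij⟩ : ∃ i j, A i j ≠ 0 := by
    by_contra! h
    exact hA (Matrix.ext h)
  refine lt_of_lt_of_le (Real.sqrt_pos.2 ?_)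
    (le_sup' (fun j => Real.sqrt (∑ i, A i j ^ 2)) (mem_univ j))
  exact sum_pos' (fun i _ => sq_nonneg _) ⟨i, mem_univ i, by positivity⟩

theorem sum_sq_pos {d : ℕ} {β : Fin d → ℝ} (hβ : β ≠ 0) : 0 < ∑ i, β i ^ 2 := by
  obtain ⟨i, hi⟩ := Function.ne_iff.1 hβ
  have hi : β i ≠ 0 := hi
  exact sum_pos' (fun i _ => sq_nonneg _) ⟨i, mem_univ i, by positivity⟩

theorem sparseSingVal_nonneg {n d : ℕ} [NeZero d] (A : Matrix (Fin n) (Fin d) ℝ) (s : ℕ) :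
    0 ≤ sparseSingVal A s := by
  refine Real.sInf_nonneg ?_
  rintro r ⟨β, -, -, rfl⟩
  have := colMaxNorm_nonneg A
  positivity

theorem sparseSingVal_le {n d : ℕ} [NeZero d] (A : Matrix (Fin n) (Fin d) ℝ) {s : ℕ}
    {β : Fin d → ℝ} (hβ : β ≠ 0) (hs : (univ.filter fun i => β i ≠ 0).card ≤ s) :
    sparseSingVal A s
      ≤ Real.sqrt (∑ j, A.mulVec β j ^ 2) / (colMaxNorm A * Real.sqrt (∑ i, β i ^ 2)) := by
  refine csInf_le ⟨0, ?_⟩ ⟨β, hβ, hs, rfl⟩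
  rintro r ⟨β, -, -, rfl⟩
  have := colMaxNorm_nonneg A
  positivity

theorem le_sparseSingVal {n d : ℕ} [NeZero d] {A : Matrix (Fin n) (Fin d) ℝ} {s : ℕ}
    (hs : 1 ≤ s) {c : ℝ}
    (h : ∀ β : Fin d → ℝ, β ≠ 0 → (univ.filter fun i => β i ≠ 0).card ≤ s →
      c ≤ Real.sqrt (∑ j, A.mulVec β j ^ 2) / (colMaxNorm A * Real.sqrt (∑ i, β i ^ 2))) :
    c ≤ sparseSingVal A s := by
  refine le_csInf ⟨_, Pi.single 0 1, ?_, ?_, rfl⟩ ?_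
  · simp
  · refine (card_le_one.2 fun a ha b hb => ?_).trans hs
    simp only [mem_filter, mem_univ, true_and, Pi.single_apply, ne_eq, ite_eq_right_iff,
      one_ne_zero, imp_false, not_not] at ha hb
    rw [ha, hb]
  · rintro r ⟨β, hβ, hc, rfl⟩
    exact h β hβ hc

theorem card_support_cons_le {d : ℕ} (c : ℝ) (β : Fin d → ℝ) :
    (univ.filter fun i => (Fin.cons c β : Fin (d + 1) → ℝ) i ≠ 0).card
      ≤ (univ.filter fun i => β i ≠ 0).card + 1 := by
  rw [Fin.card_filter_univ_succ]
  split_ifs <;> simp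

/-- Projecting out the first column does not decrease the smallest sparse scaled singular value
when the sparsity is lowered by one. -/
theorem sparseSingVal_le_sparseSingVal_proj {k l m : ℕ} [NeZero m]
    (X : Matrix (Fin k) (Fin (m + 1)) ℝ)
    (hX1 : (fun i => X i 0) ≠ 0)
    (P : Matrix (Fin k) (Fin l) ℝ)
    (hPPt : P * P.transpose
      = 1 - Matrix.of fun i j => X i 0 * X j 0 / (∑ l, X l 0 ^ 2))
    (W : Matrix (Fin l) (Fin m) ℝ)
    (hW : W = P.transpose * Matrix.of fun i (j : Fin m) => X i j.succ)
    (hWne : W ≠ 0) (s : ℕ) (hs : 1 ≤ s) :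
    sparseSingVal X (s + 1) ≤ sparseSingVal W s := by
  set x : Fin k → ℝ := fun i => X i 0 with hx
  set Y : Matrix (Fin k) (Fin m) ℝ := Matrix.of fun i (j : Fin m) => X i j.succ with hY
  have key := sum_sq_transpose_mulVec x P hPPt
  have hxpos : 0 < ∑ a, x a ^ 2 := sum_sq_pos hX1
  have hxx : x ⬝ᵥ x = ∑ a, x a ^ 2 := by simp only [dotProduct, sq]
  have hPx : P.transpose *ᵥ x = 0 := by
    by_contra h
    have h0 := key x
    rw [hxx] at h0
    have := sum_sq_pos h
    field_simp at h0
    linarith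
  have hWX : colMaxNorm W ≤ colMaxNorm X := by
    refine sup'_le _ _ fun j _ => le_trans (Real.sqrt_le_sqrt ?_)
      (le_sup' (fun j => Real.sqrt (∑ i, X i j ^ 2)) (mem_univ j.succ))
    have hcol : ∀ i, W i j = (P.transpose *ᵥ fun a => X a j.succ) i := fun i => by
      rw [hW]; rfl
    simp only [hcol]
    rw [key]
    have : 0 ≤ (x ⬝ᵥ fun a => X a j.succ) ^ 2 / ∑ a, x a ^ 2 := by positivity
    linarith
  have hWpos := colMaxNorm_pos hWne
  refine le_sparseSingVal hs fun β hβ hc => ?_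
  set c : ℝ := -((x ⬝ᵥ (Y *ᵥ β)) / ∑ a, x a ^ 2) with hcdef
  set β' : Fin (m + 1) → ℝ := Fin.cons c β with hβ'
  have hXβ : X *ᵥ β' = c • x + Y *ᵥ β := by
    ext i
    simp [mulVec, dotProduct, Fin.sum_univ_succ, hβ', hx, hY, mul_comm]
  have horth : x ⬝ᵥ (X *ᵥ β') = 0 := by
    rw [hXβ, dotProduct_add, dotProduct_smul, hxx, smul_eq_mul, hcdef]
    field_simp
    ring
  have hWβ : W *ᵥ β = P.transpose *ᵥ (X *ᵥ β') := by
    rw [hXβ, mulVec_add, mulVec_smul, hPx, smul_zero, zero_add, hW, mulVec_mulVec]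
  have hnum : ∑ j, (W *ᵥ β) j ^ 2 = ∑ j, (X *ᵥ β') j ^ 2 := by
    rw [hWβ, key, horth]
    simp
  have hβ'ne : β' ≠ 0 := fun h => hβ (funext fun i => by simpa [hβ'] using congrFun h i.succ)
  have hle : ∑ i, β i ^ 2 ≤ ∑ i, β' i ^ 2 := by
    simp only [hβ', Fin.sum_univ_succ, Fin.cons_zero, Fin.cons_succ]
    linarith [sq_nonneg c]
  refine (sparseSingVal_le X hβ'ne ((card_support_cons_le c β).trans (by omega))).trans ?_
  rw [hnum]
  have hβpos := Real.sqrt_pos.2 (sum_sq_pos hβ)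
  have hXnonneg := colMaxNorm_nonneg X
  gcongr

/-- For any integer `2 ≤ s ≤ p`, the smallest sparse scaled singular value of
the transformed design `W̌ = PᵀX₋₁` satisfies
`φ̃^{W̌}(s−1) ≥ φ̃^X(s) − (‖X₁‖₂/‖W̌‖)·√s·max_{2 ≤ i ≤ p}|γᵢ|`.
Here `n = ν + 1`, `p = m + 1` with `ν, m ≥ 1`, and `γᵢ = X₁ᵀXᵢ/‖X₁‖₂²`. -/
theorem stmt13 (ν m : ℕ) (hν : 1 ≤ ν) [NeZero m]
    (X : Matrix (Fin (ν + 1)) (Fin (m + 1)) ℝ)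
    (hX1 : (fun i => X i 0) ≠ 0)
    (P : Matrix (Fin (ν + 1)) (Fin ν) ℝ)
    (hPtP : P.transpose * P = 1)
    (hPPt : P * P.transpose
      = 1 - Matrix.of fun i j => X i 0 * X j 0 / (∑ l, X l 0 ^ 2))
    (W : Matrix (Fin ν) (Fin m) ℝ)
    (hW : W = P.transpose * Matrix.of fun i (j : Fin m) => X i j.succ)
    (hWne : W ≠ 0)
    (s : ℕ) (hs2 : 2 ≤ s) (hsp : s ≤ m + 1) :
    sparseSingVal W (s - 1)
      ≥ sparseSingVal X s
        - (Real.sqrt (∑ l, X l 0 ^ 2) / colMaxNorm W) * Real.sqrt (s : ℝ)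
          * Finset.univ.sup' Finset.univ_nonempty
              (fun j : Fin m => |(∑ i, X i 0 * X i j.succ) / (∑ l, X l 0 ^ 2)|) := by
  obtain ⟨t, rfl⟩ : ∃ t, s = t + 1 := ⟨s - 1, by omega⟩
  have h := sparseSingVal_le_sparseSingVal_proj X hX1 P hPPt W hW hWne t (by omega)
  have hW0 := colMaxNorm_nonneg W
  have hmax : 0 ≤ Finset.univ.sup' Finset.univ_nonempty
      (fun j : Fin m => |(∑ i, X i 0 * X i j.succ) / (∑ l, X l 0 ^ 2)|) :=
    (abs_nonneg _).trans (le_sup' (fun j : Fin m =>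
      |(∑ i, X i 0 * X i j.succ) / (∑ l, X l 0 ^ 2)|) (mem_univ 0))
  rw [Nat.add_sub_cancel]
  refine (sub_le_self _ ?_).trans h
  positivity
end

section
/- Assume all columns of X are nonzero and mc(X) < 1. Then ‖X₁‖₂ · max_{2 ≤ i ≤ p} |γᵢ| / max_{2 ≤ i ≤ p} ‖(Iₙ − H)Xᵢ‖₂ = max_{2 ≤ i ≤ p} ‖HXᵢ‖₂ / max_{2 ≤ i ≤ p} ‖(Iₙ − H)Xᵢ‖₂ ≤ mc(X)/(1 − mc(X)). -/
open Matrix Finset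

/-- The mutual coherence `mc(X) = max_{i ≠ j} |XᵢᵀXⱼ|/(‖Xᵢ‖₂‖Xⱼ‖₂)` of a matrix with at
least two columns. -/
noncomputable def mutualCoherence {n m : ℕ} (X : Matrix (Fin n) (Fin (m + 2)) ℝ) : ℝ :=
  Finset.univ.offDiag.sup'
    ⟨((0 : Fin (m + 2)), (1 : Fin (m + 2))),
      Finset.mem_offDiag.mpr ⟨Finset.mem_univ _, Finset.mem_univ _, Fin.zero_ne_one⟩⟩
    fun ij => |∑ i, X i ij.1 * X i ij.2|
      / (Real.sqrt (∑ i, X i ij.1 ^ 2) * Real.sqrt (∑ i, X i ij.2 ^ 2))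

/-- The Euclidean norm of the projection of `v` onto the line through `u`. -/
lemma sqrt_sum_sq_rankOne_mulVec {ι : Type*} [Fintype ι] (u v : ι → ℝ) :
    √(∑ i, ((Matrix.of fun i j => u i * u j / ∑ l, u l ^ 2) *ᵥ v) i ^ 2)
      = √(∑ l, u l ^ 2) * |(∑ i, u i * v i) / ∑ l, u l ^ 2| := by
  have hmul : ∀ i, ((Matrix.of fun i j => u i * u j / ∑ l, u l ^ 2) *ᵥ v) i
      = u i * ((∑ i, u i * v i) / ∑ l, u l ^ 2) := by
    intro i
    simp only [Matrix.mulVec, dotProduct, Matrix.of_apply, Finset.sum_div, Finset.mul_sum]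
    exact Finset.sum_congr rfl fun j _ => by ring
  simp_rw [hmul, mul_pow]
  rw [← Finset.sum_mul, Real.sqrt_mul (Finset.sum_nonneg fun i _ => sq_nonneg _),
    Real.sqrt_sq_eq_abs]

/-- The squared Euclidean norm of the component of `v` orthogonal to `u`. -/
lemma sum_sq_one_sub_rankOne_mulVec {ι : Type*} [Fintype ι] [DecidableEq ι] (u v : ι → ℝ)
    (hu : 0 < ∑ l, u l ^ 2) :
    ∑ i, (((1 : Matrix ι ι ℝ) - Matrix.of fun i j => u i * u j / ∑ l, u l ^ 2) *ᵥ v) i ^ 2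
      = ∑ i, v i ^ 2 - (∑ i, u i * v i) ^ 2 / ∑ l, u l ^ 2 := by
  have hmul : ∀ i, (((1 : Matrix ι ι ℝ) - Matrix.of fun i j => u i * u j / ∑ l, u l ^ 2) *ᵥ v) i
      = v i - u i * ((∑ i, u i * v i) / ∑ l, u l ^ 2) := by
    intro i
    rw [Matrix.sub_mulVec, Matrix.one_mulVec, Pi.sub_apply]
    congr 1
    simp only [Matrix.mulVec, dotProduct, Matrix.of_apply, Finset.sum_div, Finset.mul_sum]
    exact Finset.sum_congr rfl fun j _ => by ring
  simp_rw [hmul]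
  generalize hγ : (∑ i, u i * v i) / ∑ l, u l ^ 2 = γ
  have hexp : ∑ i, (v i - u i * γ) ^ 2
      = ∑ i, v i ^ 2 - 2 * γ * ∑ i, u i * v i + γ ^ 2 * ∑ i, u i ^ 2 := by
    rw [Finset.mul_sum, Finset.mul_sum, ← Finset.sum_sub_distrib, ← Finset.sum_add_distrib]
    exact Finset.sum_congr rfl fun i _ => by ring
  rw [hexp, ← hγ]
  field_simp
  ring

lemma sum_sq_pos_of_ne_zero {ι : Type*} [Fintype ι] {u : ι → ℝ} (hu : u ≠ 0) :
    0 < ∑ l, u l ^ 2 := by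
  obtain ⟨i, hi⟩ := Function.ne_iff.mp hu
  exact Finset.sum_pos' (fun _ _ => sq_nonneg _) ⟨i, Finset.mem_univ i, sq_pos_of_ne_zero hi⟩

lemma le_mutualCoherence {n m : ℕ} (X : Matrix (Fin n) (Fin (m + 2)) ℝ) {i j : Fin (m + 2)}
    (hij : i ≠ j) :
    |∑ l, X l i * X l j| / (√(∑ l, X l i ^ 2) * √(∑ l, X l j ^ 2)) ≤ mutualCoherence X :=
  Finset.le_sup' (fun ij : Fin (m + 2) × Fin (m + 2) => |∑ l, X l ij.1 * X l ij.2|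
    / (√(∑ l, X l ij.1 ^ 2) * √(∑ l, X l ij.2 ^ 2))) (b := (i, j)) (by simp [hij])

lemma mutualCoherence_nonneg {n m : ℕ} (X : Matrix (Fin n) (Fin (m + 2)) ℝ) :
    0 ≤ mutualCoherence X :=
  le_trans (by positivity) (le_mutualCoherence X (Fin.zero_ne_one (n := m)))

/-- If all columns of `X` are nonzero and `mc(X) < 1`, then
`‖X₁‖₂·max_{2 ≤ i ≤ p}|γᵢ| / max_{2 ≤ i ≤ p}‖(Iₙ−H)Xᵢ‖₂
  = max_{2 ≤ i ≤ p}‖HXᵢ‖₂ / max_{2 ≤ i ≤ p}‖(Iₙ−H)Xᵢ‖₂ ≤ mc(X)/(1−mc(X))`,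
where `H = X₁X₁ᵀ/‖X₁‖₂²` and `γᵢ = X₁ᵀXᵢ/‖X₁‖₂²`. Here `n = ν + 1`, `p = m + 2`. -/
theorem stmt14 (ν m : ℕ) (hν : 1 ≤ ν)
    (X : Matrix (Fin (ν + 1)) (Fin (m + 2)) ℝ)
    (hcols : ∀ j, (fun i => X i j) ≠ 0)
    (hmc : mutualCoherence X < 1) :
    let H : Matrix (Fin (ν + 1)) (Fin (ν + 1)) ℝ :=
      Matrix.of fun i j => X i 0 * X j 0 / (∑ l, X l 0 ^ 2)
    let γ : Fin (m + 2) → ℝ := fun j => (∑ i, X i 0 * X i j) / (∑ l, X l 0 ^ 2)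
    let maxHX : ℝ := Finset.univ.sup' Finset.univ_nonempty
      (fun j : Fin (m + 1) => Real.sqrt (∑ i, (H.mulVec (fun i' => X i' j.succ) i) ^ 2))
    let maxIHX : ℝ := Finset.univ.sup' Finset.univ_nonempty
      (fun j : Fin (m + 1) => Real.sqrt (∑ i,
        (((1 : Matrix (Fin (ν + 1)) (Fin (ν + 1)) ℝ) - H).mulVec (fun i' => X i' j.succ) i) ^ 2))
    Real.sqrt (∑ l, X l 0 ^ 2)
        * (Finset.univ.sup' Finset.univ_nonempty (fun j : Fin (m + 1) => |γ j.succ|))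
        / maxIHX
      = maxHX / maxIHX
    ∧ maxHX / maxIHX ≤ mutualCoherence X / (1 - mutualCoherence X) := by
  intro H γ maxHX maxIHX
  have hpos : ∀ j, 0 < ∑ l, X l j ^ 2 := fun j => sum_sq_pos_of_ne_zero (hcols j)
  have hH : ∀ j : Fin (m + 1), √(∑ i, (H *ᵥ (fun i' => X i' j.succ)) i ^ 2)
      = √(∑ l, X l 0 ^ 2) * |γ j.succ| := fun j =>
    sqrt_sum_sq_rankOne_mulVec (fun i => X i 0) (fun i => X i j.succ)
  have hIH : ∀ j : Fin (m + 1), ∑ i, ((1 - H) *ᵥ (fun i' => X i' j.succ)) i ^ 2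
      = ∑ i, X i j.succ ^ 2 - (∑ i, X i 0 * X i j.succ) ^ 2 / ∑ l, X l 0 ^ 2 := fun j =>
    sum_sq_one_sub_rankOne_mulVec (fun i => X i 0) (fun i => X i j.succ) (hpos 0)
  have hmax : maxHX = √(∑ l, X l 0 ^ 2)
      * Finset.univ.sup' Finset.univ_nonempty (fun j : Fin (m + 1) => |γ j.succ|) := by
    rw [Finset.mul₀_sup' (Real.sqrt_nonneg _)]
    exact Finset.sup'_congr _ rfl fun j _ => hH j
  refine ⟨by rw [hmax], ?_⟩
  have hc0 := mutualCoherence_nonneg X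
  have hcoh : ∀ j : Fin (m + 1), |∑ i, X i 0 * X i j.succ|
      ≤ mutualCoherence X * (√(∑ l, X l 0 ^ 2) * √(∑ l, X l j.succ ^ 2)) := fun j =>
    (div_le_iff₀ (mul_pos (Real.sqrt_pos.mpr (hpos _)) (Real.sqrt_pos.mpr (hpos _)))).mp
      (le_mutualCoherence X (Fin.succ_ne_zero j).symm)
  set c := mutualCoherence X
  have hHle : ∀ j : Fin (m + 1), √(∑ l, X l 0 ^ 2) * |γ j.succ| ≤ c * √(∑ l, X l j.succ ^ 2) := by
    intro j
    have ha := Real.sqrt_pos.mpr (hpos 0)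
    have hγ : |γ j.succ| = |∑ i, X i 0 * X i j.succ| / √(∑ l, X l 0 ^ 2) ^ 2 := by
      rw [Real.sq_sqrt (hpos 0).le, abs_div, abs_of_pos (hpos 0)]
    rw [hγ, ← mul_div_assoc, div_le_iff₀ (by positivity)]
    nlinarith [mul_le_mul_of_nonneg_left (hcoh j) ha.le]
  have hIHle : ∀ j : Fin (m + 1), (1 - c) * √(∑ l, X l j.succ ^ 2) ≤ maxIHX := by
    intro j
    refine le_trans (Real.le_sqrt_of_sq_le ?_) (Finset.le_sup'
      (fun j : Fin (m + 1) => √(∑ i, ((1 - H) *ᵥ (fun i' => X i' j.succ)) i ^ 2))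
      (Finset.mem_univ j))
    rw [hIH j, mul_pow, Real.sq_sqrt (hpos _).le]
    have hsq : (∑ i, X i 0 * X i j.succ) ^ 2 / ∑ l, X l 0 ^ 2 ≤ c ^ 2 * ∑ l, X l j.succ ^ 2 := by
      rw [div_le_iff₀ (hpos 0), ← sq_abs]
      refine (pow_le_pow_left₀ (abs_nonneg _) (hcoh j) 2).trans_eq ?_
      rw [mul_pow, mul_pow, Real.sq_sqrt (hpos _).le, Real.sq_sqrt (hpos _).le]
      ring
    nlinarith [mul_nonneg (mul_nonneg hc0 (sub_nonneg.mpr hmc.le)) (hpos j.succ).le]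
  have hc1 : 0 < 1 - c := sub_pos.mpr hmc
  have hIHpos : 0 < maxIHX :=
    (mul_pos hc1 (Real.sqrt_pos.mpr (hpos _))).trans_le (hIHle 0)
  rw [div_le_div_iff₀ hIHpos hc1, ← le_div_iff₀ hc1]
  refine Finset.sup'_le _ _ fun j _ => ?_
  rw [hH j, le_div_iff₀ hc1]
  nlinarith [mul_le_mul_of_nonneg_left (hIHle j) hc0, mul_le_mul_of_nonneg_right (hHle j) hc1.le]
end

section
/- With the posterior Π(·|Y) decomposed as dΠ(β|Y) = π(β₁|β₋₁, Y) dβ₁ dΠ₋₁(β₋₁|Y), if Q̂₋₁ minimizes Q₋₁ ↦ KL(Q₋₁ ‖ Π₋₁(·|Y)) over the family 𝒬₋₁, then the element V(π(·|β₋₁, Y), Q̂₋₁) of 𝒱 — obtained by taking the exact posterior conditional density of β₁ given β₋₁ together with Q̂₋₁ — minimizes V ↦ KL(V ‖ Π(·|Y)) over all V ∈ 𝒱; i.e. KL(V(π(·|β₋₁, Y), Q̂₋₁) ‖ Π(·|Y)) ≤ KL(V(q, Q₋₁) ‖ Π(·|Y)) for every q ∈ 𝒟 and Q₋₁ ∈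 𝒬₋₁. -/
open MeasureTheory Classical

/-- The Kullback–Leibler divergence `KL(P‖Q) ∈ [0, ∞]`, equal to `∫ log(dP/dQ) dP` when
`P ≪ Q` and this integral is well defined, and to `+∞` otherwise. -/
noncomputable def klDiv' {α : Type*} [MeasurableSpace α]
    (P Q : MeasureTheory.Measure α) : ENNReal :=
  if P ≪ Q ∧ MeasureTheory.Integrable (fun x => Real.log (P.rnDeriv Q x).toReal) P
  then ENNReal.ofReal (∫ x, Real.log (P.rnDeriv Q x).toReal ∂P)
  else ⊤

open InformationTheory ProbabilityTheory

/-- On probability measures, `klDiv'` agrees with Mathlib's `klDiv`. -/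
lemma klDiv'_eq_klDiv {α : Type*} [MeasurableSpace α] (P Q : Measure α)
    [IsProbabilityMeasure P] [IsProbabilityMeasure Q] : klDiv' P Q = klDiv P Q := by
  simp [klDiv', klDiv_def, llr_def]

section DensityKernel

variable {α β : Type*} [MeasurableSpace α] [MeasurableSpace β]

/-- The kernel `b ↦ f(·, b) dν ⊗ δ_b`. -/
noncomputable def densityKernel (ν : Measure α) [SFinite ν] (f : α × β → ENNReal) :
    Kernel β (α × β) :=
  Kernel.withDensity (Kernel.const β ν) (fun b a => f (a, b)) ×ₖ Kernel.id

variable {ν : Measure α} {f : α × β → ENNReal}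

lemma measurable_uncurry_swap (hf : Measurable f) :
    Measurable (Function.uncurry fun (b : β) (a : α) => f (a, b)) :=
  hf.comp measurable_swap

lemma isMarkovKernel_withDensity_const [SFinite ν] (hf : Measurable f)
    (hf_one : ∀ b, ∫⁻ a, f (a, b) ∂ν = 1) :
    IsMarkovKernel (Kernel.withDensity (Kernel.const β ν) (fun b a => f (a, b))) := by
  refine ⟨fun b => ⟨?_⟩⟩
  rw [Kernel.withDensity_apply' _ (measurable_uncurry_swap hf)]
  simpa using hf_one b

lemma isMarkovKernel_densityKernel [SFinite ν] (hf : Measurable f)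
    (hf_one : ∀ b, ∫⁻ a, f (a, b) ∂ν = 1) : IsMarkovKernel (densityKernel ν f) := by
  have := isMarkovKernel_withDensity_const hf hf_one
  unfold densityKernel
  infer_instance

lemma bind_densityKernel [SigmaFinite ν] (hf : Measurable f)
    (hf_one : ∀ b, ∫⁻ a, f (a, b) ∂ν = 1) (μ : Measure β) [SFinite μ] :
    μ.bind (densityKernel ν f) = (ν.prod μ).withDensity f := by
  have := isMarkovKernel_withDensity_const hf hf_one
  ext s hs
  rw [Measure.bind_apply hs (Kernel.aemeasurable _), withDensity_apply _ hs,
    ← lintegral_indicator hs, lintegral_prod_symm _ (hf.indicator hs).aemeasurable]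
  refine lintegral_congr fun b => ?_
  have hsb : MeasurableSet ((fun a => (a, b)) ⁻¹' s) := measurable_prodMk_right hs
  rw [densityKernel, Kernel.prod_apply, Kernel.id_apply, Measure.prod_dirac,
    Measure.map_apply measurable_prodMk_right hs,
    Kernel.withDensity_apply' _ (measurable_uncurry_swap hf), Kernel.const_apply,
    ← lintegral_indicator hsb]
  rfl

lemma isProbabilityMeasure_prod_withDensity [SigmaFinite ν] (hf : Measurable f)
    (hf_one : ∀ b, ∫⁻ a, f (a, b) ∂ν = 1) (μ : Measure β) [IsProbabilityMeasure μ] :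
    IsProbabilityMeasure ((ν.prod μ).withDensity f) := by
  have := isMarkovKernel_densityKernel hf hf_one
  rw [← bind_densityKernel hf hf_one]
  infer_instance

lemma map_snd_prod_withDensity [SigmaFinite ν] (hf : Measurable f)
    (hf_one : ∀ b, ∫⁻ a, f (a, b) ∂ν = 1) (μ : Measure β) [SFinite μ] :
    ((ν.prod μ).withDensity f).map Prod.snd = μ := by
  have := isMarkovKernel_withDensity_const hf hf_one
  rw [← bind_densityKernel hf hf_one, Measure.map_comp _ _ measurable_snd, ← Kernel.snd_eq,
    densityKernel, Kernel.snd_prod, Measure.id_comp]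

end DensityKernel

lemma lintegral_ofReal_eq_one {α : Type*} [MeasurableSpace α] {μ : Measure α} {f : α → ℝ}
    (hf_nonneg : ∀ x, 0 ≤ f x) (hf : ∫ x, f x ∂μ = 1) :
    ∫⁻ x, ENNReal.ofReal (f x) ∂μ = 1 := by
  have hint : Integrable f μ := .of_integral_ne_zero (by simp [hf])
  rw [← ofReal_integral_eq_lintegral_ofReal hint (.of_forall hf_nonneg), hf, ENNReal.ofReal_one]

/-- With the posterior `Π(·|Y)` on `ℝ × ℝ^{p−1}` disintegrated as
`dΠ(β|Y) = π(β₁|β₋₁, Y) dβ₁ dΠ₋₁(β₋₁|Y)`, if `Q̂₋₁` minimizes `KL(·‖Π₋₁(·|Y))` over the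
family `𝒬₋₁`, then `V(π(·|β₋₁, Y), Q̂₋₁)` minimizes `KL(·‖Π(·|Y))` over the variational
class `𝒱`: for every conditional density `q ∈ 𝒟` and every `Q₋₁ ∈ 𝒬₋₁`,
`KL(V(π, Q̂₋₁)‖Π(·|Y)) ≤ KL(V(q, Q₋₁)‖Π(·|Y))`.  Here `p − 1 = d`. -/
theorem stmt16 (d : ℕ)
    (piDens : ℝ × (Fin d → ℝ) → ℝ) (hpi_meas : Measurable piDens)
    (hpi_nonneg : ∀ z, 0 ≤ piDens z)
    (hpi_prob : ∀ b, ∫ x, piDens (x, b) = 1)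
    (postMarg : Measure (Fin d → ℝ)) [IsProbabilityMeasure postMarg]
    (post : Measure (ℝ × (Fin d → ℝ)))
    (hpost : post = ((volume : Measure ℝ).prod postMarg).withDensity
        fun z => ENNReal.ofReal (piDens z))
    (𝒬 : Set (Measure (Fin d → ℝ)))
    (h𝒬prob : ∀ Q ∈ 𝒬, IsProbabilityMeasure Q)
    (Qhat : Measure (Fin d → ℝ)) (hQhatmem : Qhat ∈ 𝒬)
    (hQhatmin : ∀ Q ∈ 𝒬, klDiv' Qhat postMarg ≤ klDiv' Q postMarg)
    (q : ℝ × (Fin d → ℝ) → ℝ) (hq_meas : Measurable q) (hq_nonneg : ∀ z, 0 ≤ q z)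
    (hq_prob : ∀ b, ∫ x, q (x, b) = 1)
    (Q : Measure (Fin d → ℝ)) (hQmem : Q ∈ 𝒬) :
    klDiv' (((volume : Measure ℝ).prod Qhat).withDensity
        fun z => ENNReal.ofReal (piDens z)) post
      ≤ klDiv' (((volume : Measure ℝ).prod Q).withDensity
          fun z => ENNReal.ofReal (q z)) post := by
  have hpi_one b := lintegral_ofReal_eq_one (fun x => hpi_nonneg (x, b)) (hpi_prob b)
  have hq_one b := lintegral_ofReal_eq_one (fun x => hq_nonneg (x, b)) (hq_prob b)
  have hpi := hpi_meas.ennreal_ofReal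
  have hq := hq_meas.ennreal_ofReal
  have := h𝒬prob Qhat hQhatmem
  have := h𝒬prob Q hQmem
  have := isProbabilityMeasure_prod_withDensity hpi hpi_one postMarg
  have := isProbabilityMeasure_prod_withDensity hpi hpi_one Qhat
  have := isProbabilityMeasure_prod_withDensity hq hq_one Q
  have := isMarkovKernel_densityKernel hpi hpi_one
  have hmin := hQhatmin Q hQmem
  subst hpost
  rw [klDiv'_eq_klDiv, klDiv'_eq_klDiv] at hmin ⊢
  refine le_trans ?_ (hmin.trans ?_)
  · rw [← bind_densityKernel hpi hpi_one, ← bind_densityKernel hpi hpi_one]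
    exact klDiv_comp_right_le _ _ _
  · have hmap := klDiv_map_le
      (((volume : Measure ℝ).prod Q).withDensity fun z => ENNReal.ofReal (q z))
      (((volume : Measure ℝ).prod postMarg).withDensity fun z => ENNReal.ofReal (piDens z))
      measurable_snd
    rwa [map_snd_prod_withDensity hq hq_one, map_snd_prod_withDensity hpi hpi_one] at hmap
end

section
/- Let g be an everywhere-positive probability density on ℝᵏ such that log g is c-Lipschitz with respect to the Euclidean norm, let L ∈ ℝ^{k×k} be invertible, m ∈ ℝᵏ and t ∈ ℝᵏ. Then (∫_{ℝᵏ} e^{tᵀL⁻¹(x−m)} e^{−(x−m)ᵀ(LLᵀ)⁻¹(x−m)/2} g(x) dx) / (∫_{ℝᵏ} e^{−(x−m)ᵀ(LLᵀ)⁻¹(x−m)/2} g(x) dx) ≤ (∫_{ℝᵏ} e^{tᵀu − ‖u‖₂²/2 + c‖L‖_{op}‖u‖₂} du) / (∫_{ℝᵏ} e^{−‖u‖₂²/2 − c‖L‖_{op}‖u‖₂} du), where ‖L‖_{op} denotes the operator (spectral) norm of L. -/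
open Matrix MeasureTheory

/-- The operator (spectral) norm `‖L‖_op` of a square matrix, i.e. the operator norm of the
induced linear map between Euclidean spaces. -/
noncomputable def matOpNorm {k : ℕ} (L : Matrix (Fin k) (Fin k) ℝ) : ℝ :=
  ‖LinearMap.toContinuousLinearMap (Matrix.toEuclideanLin L)‖

theorem integrable_exp_dotProduct_sub_sq_add_norm {k : ℕ} (t : Fin k → ℝ) (a : ℝ) :
    Integrable (fun u : Fin k → ℝ => Real.exp (dotProduct t u - (∑ i, u i ^ 2) / 2
      + a * Real.sqrt (∑ i, u i ^ 2))) := by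
  have hprod : Integrable (fun u : Fin k → ℝ => ∏ i, Real.exp (-(1 / 4) * u i ^ 2)) :=
    Integrable.fintype_prod (f := fun (_ : Fin k) (y : ℝ) => Real.exp (-(1 / 4) * y ^ 2))
      fun _ => integrable_exp_neg_mul_sq (by norm_num)
  refine (hprod.const_mul (Real.exp (2 * ∑ i, t i ^ 2 + 2 * a ^ 2))).mono' ?_ ?_
  · refine Continuous.aestronglyMeasurable ?_
    simp only [dotProduct]
    fun_prop
  · refine Filter.Eventually.of_forall fun u => ?_
    rw [Real.norm_eq_abs, Real.abs_exp, ← Real.exp_sum, ← Real.exp_add, Real.exp_le_exp,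
      ← Finset.mul_sum]
    have hdot : dotProduct t u ≤ 2 * ∑ i, t i ^ 2 + (1 / 8) * ∑ i, u i ^ 2 := by
      rw [dotProduct, Finset.mul_sum, Finset.mul_sum, ← Finset.sum_add_distrib]
      exact Finset.sum_le_sum fun i _ => by nlinarith [sq_nonneg (4 * t i - u i)]
    have hsq := Real.sq_sqrt (Finset.sum_nonneg fun i (_ : i ∈ Finset.univ) => sq_nonneg (u i))
    nlinarith [sq_nonneg (4 * a - Real.sqrt (∑ i, u i ^ 2))]

theorem integral_eq_abs_det_mul_integral_comp_add_mulVec {k : ℕ}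
    {L : Matrix (Fin k) (Fin k) ℝ} (hL : IsUnit L.det) (mv : Fin k → ℝ)
    {F : (Fin k → ℝ) → ℝ} (hF : Measurable F) :
    ∫ x, F x = |L.det| * ∫ u, F (mv + L.mulVec u) := by
  have hmap := Real.map_matrix_volume_pi_eq_smul_volume_pi hL.ne_zero
  have hcont : Continuous (Matrix.toLin' L) := LinearMap.continuous_of_finiteDimensional _
  have h : ∫ u, F (mv + L.mulVec u) = |L.det⁻¹| * ∫ x, F x := by
    calc ∫ u, F (mv + L.mulVec u)
        = ∫ y, F (mv + y) ∂(Measure.map (Matrix.toLin' L) volume) := by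
          rw [integral_map hcont.aemeasurable
            (f := fun y => F (mv + y))
            (hF.comp (measurable_const_add mv)).aestronglyMeasurable]
          simp only [Matrix.toLin'_apply]
      _ = |L.det⁻¹| * ∫ x, F x := by
          rw [hmap, integral_smul_measure, ENNReal.toReal_ofReal (abs_nonneg _), smul_eq_mul,
            integral_add_left_eq_self]
  rw [h, ← mul_assoc, ← abs_mul, mul_inv_cancel₀ hL.ne_zero, abs_one, one_mul]

theorem sqrt_sum_sq_mulVec_le {k : ℕ} (L : Matrix (Fin k) (Fin k) ℝ) (u : Fin k → ℝ) :
    Real.sqrt (∑ i, (L.mulVec u) i ^ 2) ≤ matOpNorm L * Real.sqrt (∑ i, u i ^ 2) := by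
  have h := (LinearMap.toContinuousLinearMap (Matrix.toEuclideanLin L)).le_opNorm
    (WithLp.toLp 2 u)
  simpa [EuclideanSpace.norm_eq, Matrix.toLpLin_apply, matOpNorm] using h

theorem mulVec_dotProduct_inv_mul_transpose_mulVec {k : ℕ}
    {L : Matrix (Fin k) (Fin k) ℝ} (hL : IsUnit L.det) (u : Fin k → ℝ) :
    dotProduct (L.mulVec u) (((L * L.transpose)⁻¹).mulVec (L.mulVec u)) = ∑ i, u i ^ 2 := by
  rw [Matrix.mul_inv_rev, Matrix.mulVec_mulVec, Matrix.mul_assoc, Matrix.nonsing_inv_mul _ hL,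
    Matrix.mul_one, Matrix.dotProduct_mulVec, ← Matrix.mulVec_transpose,
    Matrix.transpose_nonsing_inv, Matrix.transpose_transpose, Matrix.mulVec_mulVec,
    Matrix.nonsing_inv_mul _ hL, Matrix.one_mulVec]
  simp [dotProduct, sq]

theorem le_mul_exp_of_abs_log_sub_log_le {a b r : ℝ} (ha : 0 < a) (hb : 0 < b)
    (h : |Real.log a - Real.log b| ≤ r) : a ≤ b * Real.exp r := by
  rw [← Real.log_le_log_iff ha (by positivity), Real.log_mul hb.ne' (Real.exp_ne_zero r),
    Real.log_exp]
  linarith [(abs_le.mp h).2]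

/-- Let `g` be an everywhere-positive probability density on `ℝᵏ` with
`log g` `c`-Lipschitz for the Euclidean norm, `L` invertible, `m, t ∈ ℝᵏ`.  Then
`(∫ e^{tᵀL⁻¹(x−m)} e^{−(x−m)ᵀ(LLᵀ)⁻¹(x−m)/2} g(x) dx)/(∫ e^{−(x−m)ᵀ(LLᵀ)⁻¹(x−m)/2} g(x) dx)
  ≤ (∫ e^{tᵀu − ‖u‖₂²/2 + c‖L‖_op‖u‖₂} du)/(∫ e^{−‖u‖₂²/2 − c‖L‖_op‖u‖₂} du)`. -/
theorem stmt18 (k : ℕ) (hk : 1 ≤ k)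
    (g : (Fin k → ℝ) → ℝ) (hg_meas : Measurable g) (hg_pos : ∀ x, 0 < g x)
    (hg_int : ∫ x, g x = 1)
    (c : ℝ) (hc : 0 ≤ c)
    (hlip : ∀ x y : Fin k → ℝ,
      |Real.log (g x) - Real.log (g y)| ≤ c * Real.sqrt (∑ i, (x i - y i) ^ 2))
    (L : Matrix (Fin k) (Fin k) ℝ) (hL : IsUnit L.det)
    (mv t : Fin k → ℝ) :
    (∫ x, Real.exp (dotProduct t (L⁻¹.mulVec (x - mv)))
          * Real.exp (-(dotProduct (x - mv) (((L * L.transpose)⁻¹).mulVec (x - mv))) / 2)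
          * g x)
        / (∫ x, Real.exp (-(dotProduct (x - mv)
              (((L * L.transpose)⁻¹).mulVec (x - mv))) / 2) * g x)
      ≤ (∫ u : Fin k → ℝ, Real.exp (dotProduct t u - (∑ i, u i ^ 2) / 2
            + c * matOpNorm L * Real.sqrt (∑ i, u i ^ 2)))
        / (∫ u : Fin k → ℝ, Real.exp (-(∑ i, u i ^ 2) / 2
            - c * matOpNorm L * Real.sqrt (∑ i, u i ^ 2))) := by
  have hinv (u : Fin k → ℝ) : L⁻¹.mulVec (L.mulVec u) = u := by
    rw [Matrix.mulVec_mulVec, Matrix.nonsing_inv_mul _ hL, Matrix.one_mulVec]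
  set A := c * matOpNorm L with hA
  have hlog (u : Fin k → ℝ) : |Real.log (g (mv + L.mulVec u)) - Real.log (g mv)|
      ≤ A * Real.sqrt (∑ i, u i ^ 2) := by
    refine (hlip _ _).trans ?_
    simp only [Pi.add_apply, add_sub_cancel_left]
    rw [hA, mul_assoc]
    exact mul_le_mul_of_nonneg_left (sqrt_sum_sq_mulVec_le L u) hc
  have hup (u : Fin k → ℝ) := le_mul_exp_of_abs_log_sub_log_le (hg_pos _) (hg_pos _) (hlog u)
  have hlow (u : Fin k → ℝ) := le_mul_exp_of_abs_log_sub_log_le (hg_pos _) (hg_pos _)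
    ((abs_sub_comm _ _).trans_le (hlog u))
  have hquad : Measurable fun x : Fin k → ℝ => Real.exp (-(dotProduct (x - mv)
      (((L * L.transpose)⁻¹).mulVec (x - mv))) / 2) := by
    refine Continuous.measurable ?_
    fun_prop
  have htilt : Measurable fun x : Fin k → ℝ =>
      Real.exp (dotProduct t (L⁻¹.mulVec (x - mv))) := by
    refine Continuous.measurable ?_
    fun_prop
  rw [integral_eq_abs_det_mul_integral_comp_add_mulVec hL mv ((htilt.fun_mul hquad).fun_mul hg_meas),
    integral_eq_abs_det_mul_integral_comp_add_mulVec hL mv (hquad.fun_mul hg_meas),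
    mul_div_mul_left _ _ (abs_ne_zero.mpr hL.ne_zero)]
  simp only [add_sub_cancel_left, hinv,
    mulVec_dotProduct_inv_mul_transpose_mulVec hL]
  have hint := integrable_exp_dotProduct_sub_sq_add_norm t A
  have hint_low : Integrable fun u : Fin k → ℝ => Real.exp (-(∑ i, u i ^ 2) / 2
      - A * Real.sqrt (∑ i, u i ^ 2)) := by
    refine (integrable_exp_dotProduct_sub_sq_add_norm 0 (-A)).congr
      (Filter.Eventually.of_forall fun u => ?_)
    simp only [zero_dotProduct]
    ring_nf
  have hint_den : Integrable fun u : Fin k → ℝ =>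
      Real.exp (-(∑ i, u i ^ 2) / 2) * g (mv + L.mulVec u) := by
    refine ((integrable_exp_dotProduct_sub_sq_add_norm 0 A).const_mul (g mv)).mono' ?_ ?_
    · have hcont : Continuous fun u : Fin k → ℝ => mv + L.mulVec u := by fun_prop
      have hexp : Continuous fun u : Fin k → ℝ => Real.exp (-(∑ i, u i ^ 2) / 2) := by fun_prop
      exact (hexp.measurable.mul (hg_meas.comp hcont.measurable)).aestronglyMeasurable
    · refine Filter.Eventually.of_forall fun u => ?_
      rw [Real.norm_of_nonneg (mul_pos (Real.exp_pos _) (hg_pos _)).le]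
      calc Real.exp (-(∑ i, u i ^ 2) / 2) * g (mv + L.mulVec u)
          ≤ Real.exp (-(∑ i, u i ^ 2) / 2) *
            (g mv * Real.exp (A * Real.sqrt (∑ i, u i ^ 2))) := by gcongr; exact hup u
        _ = _ := by
          rw [mul_left_comm, ← Real.exp_add, zero_dotProduct]
          ring_nf
  have hnum : ∫ u : Fin k → ℝ, Real.exp (dotProduct t u) * Real.exp (-(∑ i, u i ^ 2) / 2)
        * g (mv + L.mulVec u)
      ≤ g mv * ∫ u : Fin k → ℝ, Real.exp (dotProduct t u - (∑ i, u i ^ 2) / 2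
        + A * Real.sqrt (∑ i, u i ^ 2)) := by
    rw [← integral_const_mul]
    refine integral_mono_of_nonneg (Filter.Eventually.of_forall fun u => ?_)
      (hint.const_mul _) (Filter.Eventually.of_forall fun u => ?_)
    · exact mul_nonneg (by positivity) (hg_pos _).le
    · calc Real.exp (dotProduct t u) * Real.exp (-(∑ i, u i ^ 2) / 2) * g (mv + L.mulVec u)
          ≤ Real.exp (dotProduct t u) * Real.exp (-(∑ i, u i ^ 2) / 2) *
            (g mv * Real.exp (A * Real.sqrt (∑ i, u i ^ 2))) := by gcongr; exact hup u
        _ = _ := by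
          rw [mul_left_comm, ← Real.exp_add, ← Real.exp_add]
          ring_nf
  have hden : g mv * ∫ u : Fin k → ℝ, Real.exp (-(∑ i, u i ^ 2) / 2
        - A * Real.sqrt (∑ i, u i ^ 2))
      ≤ ∫ u : Fin k → ℝ, Real.exp (-(∑ i, u i ^ 2) / 2) * g (mv + L.mulVec u) := by
    rw [← integral_const_mul]
    refine integral_mono (hint_low.const_mul _) hint_den fun u => ?_
    simp only [Real.exp_sub, mul_div_assoc']
    rw [div_le_iff₀ (Real.exp_pos _), mul_comm (g mv), mul_assoc]
    gcongr
    exact hlow u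
  have hpos : 0 < ∫ u : Fin k → ℝ, Real.exp (-(∑ i, u i ^ 2) / 2
      - A * Real.sqrt (∑ i, u i ^ 2)) := integral_exp_pos hint_low
  refine (div_le_div₀ ?_ hnum (mul_pos (hg_pos mv) hpos) hden).trans_eq
    (mul_div_mul_left _ _ (hg_pos mv).ne')
  exact mul_nonneg (hg_pos mv).le (integral_nonneg fun u => (Real.exp_pos _).le)
end
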